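/- Let B be a C*-algebra of stable rank 1 and let a, b be positive contractions in B such that for every t ∈ (0,1) the elements (a − t)_+ and (b − t)_+ are Cuntz equivalent in B. Then a and b are approximately unitarily equivalent: for every ε > 0 there exists a unitary u in the unitization B~ with ‖u* a u − b‖ < ε. (This is the uniqueness half of the classification of homomorphisms from C₀(0,1] into a stable rank 1 C*-algebra, the base case of the paper's main classification theorem.) -/

import Mathlib

open Filter Topology

/-- `a` is Cuntz subequivalent to `b`: there is a sequence `dₙ` with `dₙ b dₙ* → a`. -/
def CuntzSubequivalent {D : Type*} [NonUnitalRing D] [TopologicalSpace D] [Star D]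
    (a b : D) : Prop :=
  ∃ d : ℕ → D, Tendsto (fun n => d n * b * star (d n)) atTop (𝓝 a)

/-- Cuntz equivalence: subequivalence in both directions. -/
def CuntzEquivalent {D : Type*} [NonUnitalRing D] [TopologicalSpace D] [Star D]
    (a b : D) : Prop :=
  CuntzSubequivalent a b ∧ CuntzSubequivalent b a

/-- A C*-algebra has stable rank one if the invertible elements of its minimal
unitization are dense. -/
def StableRankOne (B : Type*) [NonUnitalCStarAlgebra B] : Prop :=
  Dense {x : Unitization ℂ B | IsUnit x}

/-- An element intertwines the functional calculi of `z⋆z` and `zz⋆`. -/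
theorem mul_cfc_star_mul_self {A : Type*} [CStarAlgebra A] (z : A) {f : ℝ → ℝ}
    (hf : Continuous f) : z * cfc f (star z * z) = cfc f (z * star z) * z := by
  have hs₁ : IsSelfAdjoint (star z * z) := .star_mul_self z
  have hs₂ : IsSelfAdjoint (z * star z) := .mul_star_self z
  have key (p : Polynomial ℝ) :
      z * Polynomial.aeval (star z * z) p = Polynomial.aeval (z * star z) p * z := by
    induction p using Polynomial.induction_on' with
    | add p q hp hq => simp [mul_add, add_mul, hp, hq]
    | monomial n r =>
      have hpow : z * (star z * z) ^ n = (z * star z) ^ n * z := by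
        have : SemiconjBy z (star z * z) (z * star z) := by simp [SemiconjBy, mul_assoc]
        exact (this.pow_right n).eq
      rw [Polynomial.aeval_monomial, Polynomial.aeval_monomial, ← mul_assoc,
        ← Algebra.commutes, mul_assoc, hpow, mul_assoc]
  set K : ℝ := ‖z‖ * ‖z‖ with hK
  have hsp₁ : ∀ x ∈ spectrum ℝ (star z * z), x ∈ Set.Icc (-K) K := fun x hx ↦ by
    have := IsometricContinuousFunctionalCalculus.norm_spectrum_le (star z * z) hx
    rw [CStarRing.norm_star_mul_self] at this
    exact abs_le.1 this
  have hsp₂ : ∀ x ∈ spectrum ℝ (z * star z), x ∈ Set.Icc (-K) K := fun x hx ↦ by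
    have := IsometricContinuousFunctionalCalculus.norm_spectrum_le (z * star z) hx
    rw [CStarRing.norm_self_mul_star] at this
    exact abs_le.1 this
  rw [← sub_eq_zero, ← norm_le_zero_iff]
  refine le_of_forall_pos_le_add fun ε hε ↦ ?_
  obtain ⟨p, hp⟩ := exists_polynomial_near_of_continuousOn (-K) K f hf.continuousOn
    (ε / (2 * (‖z‖ + 1))) (by positivity)
  have approx {x : A} (hx : IsSelfAdjoint x) (h : ∀ s ∈ spectrum ℝ x, s ∈ Set.Icc (-K) K) :
      ‖cfc f x - Polynomial.aeval x p‖ ≤ ε / (2 * (‖z‖ + 1)) := by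
    rw [← cfc_polynomial p x, ← cfc_sub f p.eval x]
    refine norm_cfc_le (by positivity) fun s hs ↦ ?_
    rw [norm_sub_rev]
    exact (hp s (h s hs)).le
  have e : z * cfc f (star z * z) - cfc f (z * star z) * z =
      z * (cfc f (star z * z) - Polynomial.aeval (star z * z) p) -
      (cfc f (z * star z) - Polynomial.aeval (z * star z) p) * z := by
    rw [mul_sub, sub_mul, key]; abel
  rw [e, zero_add]
  calc _ ≤ ‖z‖ * (ε / (2 * (‖z‖ + 1))) + (ε / (2 * (‖z‖ + 1))) * ‖z‖ := by
        refine (norm_sub_le _ _).trans (add_le_add ?_ ?_)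
        · exact (norm_mul_le _ _).trans (by gcongr; exact approx hs₁ hsp₁)
        · exact (norm_mul_le _ _).trans (by gcongr; exact approx hs₂ hsp₂)
    _ ≤ ε := by
        field_simp
        nlinarith [norm_nonneg z]

/-- The unitary part of an invertible element. -/
theorem exists_unitary_eq_mul_abs {A : Type*} [CStarAlgebra A] [PartialOrder A]
    [StarOrderedRing A] {x : A} (hx : IsUnit x) : ∃ w ∈ unitary A, x = w * CFC.abs x := by
  have hsq : CFC.abs x * CFC.abs x = star x * x := CFC.abs_mul_abs x
  have hm : IsUnit (CFC.abs x) := by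
    have h : IsUnit (CFC.abs x * CFC.abs x) := hsq ▸ hx.star.mul hx
    exact ((Commute.refl (CFC.abs x)).isUnit_mul_iff.1 h).1
  obtain ⟨m, hm'⟩ := hm
  have hmsa : star (m : A) = m := by
    rw [hm']; exact (IsSelfAdjoint.of_nonneg (CFC.abs_nonneg x)).star_eq
  have hminv : star (↑m⁻¹ : A) = ↑m⁻¹ := by
    rw [← Units.coe_star_inv, inv_inj.2 (Units.ext (by simpa using hmsa))]
  rw [← hm'] at hsq ⊢
  refine ⟨x * ↑m⁻¹, ?_, by simp⟩
  have h1 : star (x * ↑m⁻¹) * (x * ↑m⁻¹) = 1 := by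
    rw [star_mul, hminv, mul_assoc, ← mul_assoc (star x), ← hsq]
    simp
  refine Unitary.mem_iff.2 ⟨h1, ?_⟩
  obtain ⟨v, hv⟩ : IsUnit (x * (↑m⁻¹ : A)) := hx.mul m⁻¹.isUnit
  rw [← hv] at h1 ⊢
  have hsv : star (v : A) = ↑v⁻¹ := by
    rw [← one_mul (↑v⁻¹ : A), Units.eq_mul_inv_iff_mul_eq, h1]
  rw [hsv, Units.mul_inv]

/-- If `z` is a limit of invertible elements, then the images of `z⋆z` and `zz⋆` under a function
vanishing near `0` are unitarily equivalent. -/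
theorem exists_unitary_conj_cfc {A : Type*} [CStarAlgebra A] {z : A}
    (hz : z ∈ closure {y : A | IsUnit y}) {κ : ℝ} (hκ : 0 < κ) {Φ : ℝ → ℝ} (hΦ : Continuous Φ)
    (hΦ0 : ∀ s ≤ κ, Φ s = 0) :
    ∃ w ∈ unitary A, w * cfc Φ (star z * z) * star w = cfc Φ (z * star z) := by
  let : PartialOrder A := CStarAlgebra.spectralOrder A
  have : StarOrderedRing A := CStarAlgebra.spectralOrderedRing A
  have hmax (s : ℝ) : max s κ ≠ 0 := (lt_max_of_lt_right hκ).ne'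
  have hg : Continuous fun s : ℝ ↦ (max s κ)⁻¹ := by fun_prop (disch := exact hmax _)
  have hF : Continuous fun s : ℝ ↦ Φ s * (max s κ)⁻¹ := hΦ.mul hg
  have hdiv (s : ℝ) : Φ s = s * (Φ s * (max s κ)⁻¹) := by
    rcases le_total s κ with h | h
    · simp [hΦ0 s h]
    · have := (hκ.trans_le h).ne'
      rw [max_eq_left h]
      field_simp
  set r : A := cfc (fun s : ℝ ↦ (max s κ)⁻¹) (star z * z) * star z with hr
  set F : A := cfc (fun s : ℝ ↦ Φ s * (max s κ)⁻¹) (star z * z) with hFdef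
  set F' : A := cfc (fun s : ℝ ↦ Φ s * (max s κ)⁻¹) (z * star z) with hF'def
  have hs₁ : IsSelfAdjoint (star z * z) := .star_mul_self z
  have hs₂ : IsSelfAdjoint (z * star z) := .mul_star_self z
  have hFsa : star F = F := IsSelfAdjoint.star_eq (IsSelfAdjoint.cfc)
  have hF'sa : star F' = F' := IsSelfAdjoint.star_eq (IsSelfAdjoint.cfc)
  have hzF : z * F = F' * z := mul_cfc_star_mul_self z hF
  have hrF : (1 - r * z) * F = 0 := by
    have h1 : r * z = cfc (fun s : ℝ ↦ (max s κ)⁻¹ * s) (star z * z) := by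
      rw [cfc_mul (fun s : ℝ ↦ (max s κ)⁻¹) (fun s ↦ s) _ hg.continuousOn, cfc_id' ℝ (star z * z),
        hr, mul_assoc]
    rw [sub_mul, one_mul, h1, hFdef, ← cfc_mul _ _ _ (by fun_prop) hF.continuousOn, sub_eq_zero]
    exact cfc_congr fun s _ ↦ by grind
  have hF'r : F' * (1 - z * r) = 0 := by
    have h1 : z * r = cfc (fun s : ℝ ↦ (max s κ)⁻¹ * s) (z * star z) := by
      rw [cfc_mul (fun s : ℝ ↦ (max s κ)⁻¹) (fun s ↦ s) _ hg.continuousOn, cfc_id' ℝ (z * star z),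
        hr, ← mul_assoc, mul_cfc_star_mul_self z hg, mul_assoc]
    rw [mul_sub, mul_one, h1, hF'def, ← cfc_mul _ _ _ hF.continuousOn (by fun_prop), sub_eq_zero]
    exact cfc_congr fun s _ ↦ by grind
  have hΦ₁ : cfc Φ (star z * z) = star z * z * F := by
    nth_rw 2 [← cfc_id' ℝ (star z * z)]
    rw [hFdef, ← cfc_mul _ _ _ (by fun_prop) hF.continuousOn]
    exact cfc_congr fun s _ ↦ hdiv s
  have hΦ₂ : cfc Φ (z * star z) = F' * (z * star z) := by
    nth_rw 2 [← cfc_id' ℝ (z * star z)]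
    rw [hF'def, ← cfc_mul _ _ _ hF.continuousOn (by fun_prop)]
    exact cfc_congr fun s _ ↦ (hdiv s).trans (mul_comm _ _)
  -- choose a small perturbation
  obtain ⟨e, hze, h1, h2⟩ : ∃ e : A, IsUnit (z + e) ∧ IsUnit (1 + r * e) ∧
      IsUnit (1 + (1 - z * r) * e * Ring.inverse (1 + r * e) * r) := by
    have hinv : ContinuousAt (fun e : A ↦ Ring.inverse (1 + r * e)) 0 := by
      have := NormedRing.inverse_continuousAt (1 : Aˣ)
      refine ContinuousAt.comp (g := Ring.inverse) ?_ (by fun_prop)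
      simpa using this
    have hE : ContinuousAt
        (fun e : A ↦ 1 + (1 - z * r) * e * Ring.inverse (1 + r * e) * r) 0 := by fun_prop
    have hE' : ContinuousAt (fun e : A ↦ 1 + r * e) 0 := by fun_prop
    have hU : {y : A | IsUnit y} ∈ 𝓝 (1 : A) := Units.isOpen.mem_nhds isUnit_one
    have hU1 : ∀ᶠ e in 𝓝 (0 : A), IsUnit (1 + r * e) :=
      hE'.eventually (p := IsUnit) (by simpa using! hU)
    have hU2 : ∀ᶠ e in 𝓝 (0 : A),
        IsUnit (1 + (1 - z * r) * e * Ring.inverse (1 + r * e) * r) :=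
      hE.eventually (p := IsUnit) (by simpa using! hU)
    have hfr : ∃ᶠ y in 𝓝 z, IsUnit y := mem_closure_iff_frequently.1 hz
    have ht : Tendsto (fun y : A ↦ y - z) (𝓝 z) (𝓝 0) := by
      have : ContinuousAt (fun y : A ↦ y - z) z := by fun_prop
      simpa [ContinuousAt] using this
    obtain ⟨y, hy, hy'⟩ := (hfr.and_eventually (ht.eventually (hU1.and hU2))).exists
    exact ⟨y - z, by simpa using hy, hy'⟩
  obtain ⟨v₁, hv₁⟩ := h1
  rw [← hv₁, Ring.inverse_unit] at h2
  set E : A := (1 - z * r) * e * ↑v₁⁻¹ with hE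
  obtain ⟨v₂, hv₂⟩ := h2
  have hz' : z + E = (z + e) * ↑v₁⁻¹ := by
    have : z = z * v₁ * ↑v₁⁻¹ := by simp
    nth_rw 1 [this]
    rw [hE, ← add_mul, hv₁]
    congr 1
    noncomm_ring
  -- the perturbed invertible element
  set x : A := ↑v₂⁻¹ * (z + E) with hx
  have hxu : IsUnit x := by
    rw [hx, hz']
    exact v₂⁻¹.isUnit.mul (hze.mul v₁⁻¹.isUnit)
  have hx1 : x = z + ↑v₂⁻¹ * E * (1 - r * z) := by
    rw [hx, Units.inv_mul_eq_iff_eq_mul, mul_add, mul_assoc, Units.mul_inv_cancel_left, hv₂]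
    noncomm_ring
  have hF'E : F' * E = 0 := by rw [hE, ← mul_assoc, ← mul_assoc, hF'r]; simp
  have hF'v : F' * ↑v₂⁻¹ = F' := by
    have : F' * v₂ = F' := by rw [hv₂, mul_add, mul_one, ← mul_assoc, hF'E, zero_mul, add_zero]
    nth_rw 1 [← this]
    simp
  have hxF : x * F = z * F := by rw [hx1, add_mul, mul_assoc, hrF, mul_zero, add_zero]
  have hF'x : F' * x = F' * z := by
    rw [hx, ← mul_assoc, hF'v, mul_add, hF'E, add_zero]
  have hFx' : star x * z * F = star z * z * F := by
    rw [mul_assoc, hzF, ← mul_assoc, ← hF'sa, ← star_mul, hF'x, star_mul, hF'sa, mul_assoc, ← hzF,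
      mul_assoc]
  have hsqF : star x * x * F = star z * z * F := by rw [mul_assoc, hxF, ← mul_assoc, hFx']
  have hcomm : Commute (star x * x) F := by
    have h1 : star (star z * z * F) = star z * z * F := by
      have := (cfc_predicate Φ (star z * z)).star_eq
      rwa [hΦ₁] at this
    rw [Commute, SemiconjBy, hsqF, ← h1, ← hsqF]
    simp [star_mul, hFsa, mul_assoc]
  have habs : Commute (CFC.abs x) F := by
    rw [CFC.abs, CFC.sqrt]
    exact hcomm.cfcₙ_nnreal _
  obtain ⟨w, hw, hxw⟩ := exists_unitary_eq_mul_abs hxu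
  have habsa : star (CFC.abs x) = CFC.abs x := (IsSelfAdjoint.of_nonneg (CFC.abs_nonneg x)).star_eq
  refine ⟨w, hw, ?_⟩
  calc w * cfc Φ (star z * z) * star w = w * (CFC.abs x * CFC.abs x * F) * star w := by
        rw [CFC.abs_mul_abs, hsqF, hΦ₁]
    _ = (w * CFC.abs x) * F * star (w * CFC.abs x) := by
        rw [star_mul, habsa, mul_assoc (CFC.abs x), habs.eq]; simp only [mul_assoc]
    _ = x * F * star x := by rw [← hxw]
    _ = F' * (z * star z) := by
        rw [hxF, hzF, mul_assoc, ← mul_assoc, ← hzF]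
        rw [mul_assoc, ← hFsa, ← star_mul, hxF, star_mul, hFsa, ← mul_assoc, hzF, mul_assoc]
    _ = _ := hΦ₂.symm

theorem isUnit_one_add_mul_swap {A : Type*} [Ring A] {x y : A} (h : IsUnit (1 + x * y)) :
    IsUnit (1 + y * x) := by
  obtain ⟨v, hv⟩ := h
  have h1 : x * y * (↑v⁻¹ : A) = 1 - ↑v⁻¹ := by
    rw [eq_sub_iff_add_eq, ← one_mul (↑v⁻¹ : A), ← mul_assoc, mul_one, ← add_mul, add_comm, ← hv,
      Units.mul_inv]
  have h2 : (↑v⁻¹ : A) * (x * y) = 1 - ↑v⁻¹ := by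
    rw [eq_sub_iff_add_eq, ← mul_one (↑v⁻¹ : A), mul_assoc, one_mul, ← mul_add, add_comm, ← hv,
      Units.inv_mul]
  refine ⟨⟨1 + y * x, 1 - y * ↑v⁻¹ * x, ?_, ?_⟩, rfl⟩
  · calc _ = 1 + y * x - y * ↑v⁻¹ * x - y * (x * y * ↑v⁻¹) * x := by noncomm_ring
      _ = 1 := by rw [h1]; noncomm_ring
  · calc _ = 1 + y * x - y * ↑v⁻¹ * x - y * (↑v⁻¹ * (x * y)) * x := by noncomm_ring
      _ = 1 := by rw [h2]; noncomm_ring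

/-- The closed right ideal generated by an element. -/
noncomputable def closedRightIdeal {A : Type*} [CStarAlgebra A] (c : A) : Submodule ℂ A :=
  (LinearMap.range (LinearMap.mulLeft ℂ c)).topologicalClosure

section ClosedRightIdeal

variable {A : Type*} [CStarAlgebra A]

theorem isClosed_closedRightIdeal (c : A) : IsClosed (closedRightIdeal c : Set A) :=
  Submodule.isClosed_topologicalClosure _

theorem mul_mem_closedRightIdeal (c x : A) : c * x ∈ closedRightIdeal c :=
  Submodule.le_topologicalClosure _ ⟨x, rfl⟩

theorem self_mem_closedRightIdeal (c : A) : c ∈ closedRightIdeal c := by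
  simpa using mul_mem_closedRightIdeal c 1

theorem map_mem_closedRightIdeal {c y : A} (hy : y ∈ closedRightIdeal c) {d : A} {f : A → A}
    (hf : Continuous f) (h : ∀ x, f (c * x) ∈ closedRightIdeal d) : f y ∈ closedRightIdeal d := by
  have hy' : y ∈ closure (LinearMap.range (LinearMap.mulLeft ℂ c) : Set A) := hy
  have := map_mem_closure (t := (closedRightIdeal d : Set A)) hf hy' (by
    rintro _ ⟨x, rfl⟩
    exact h x)
  rwa [(isClosed_closedRightIdeal d).closure_eq] at this

theorem mul_right_mem_closedRightIdeal {c y : A} (hy : y ∈ closedRightIdeal c) (x : A) :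
    y * x ∈ closedRightIdeal c :=
  map_mem_closedRightIdeal (f := (· * x)) hy (by fun_prop) fun m ↦ by
    simpa only [mul_assoc] using mul_mem_closedRightIdeal c (m * x)

theorem closedRightIdeal_le {c d : A} (h : c ∈ closedRightIdeal d) :
    closedRightIdeal c ≤ closedRightIdeal d := fun _ hy ↦
  map_mem_closedRightIdeal (f := id) hy continuous_id fun m ↦ mul_right_mem_closedRightIdeal h m

theorem mul_left_mem_closedRightIdeal {c y : A} (hy : y ∈ closedRightIdeal c) (u : A) :
    u * y ∈ closedRightIdeal (u * c) :=
  map_mem_closedRightIdeal (f := (u * ·)) hy (by fun_prop) fun m ↦ by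
    simpa only [mul_assoc] using mul_mem_closedRightIdeal (u * c) m

/-- The functional calculus of a function vanishing near `0` stays in the closed right ideal. -/
theorem cfc_mem_closedRightIdeal {a : A} (ha : IsSelfAdjoint a) {κ : ℝ} (hκ : 0 < κ) {f : ℝ → ℝ}
    (hf : Continuous f) (hf0 : ∀ s ≤ κ, f s = 0) : cfc f a ∈ closedRightIdeal a := by
  have hmax (s : ℝ) : max s κ ≠ 0 := (lt_max_of_lt_right hκ).ne'
  have hg : Continuous fun s : ℝ ↦ f s * (max s κ)⁻¹ := by fun_prop (disch := exact hmax _)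
  have : cfc f a = a * cfc (fun s : ℝ ↦ f s * (max s κ)⁻¹) a := by
    nth_rw 2 [← cfc_id' ℝ a]
    rw [← cfc_mul _ _ _ (by fun_prop) hg.continuousOn]
    refine cfc_congr fun s _ ↦ ?_
    rcases le_total s κ with h | h
    · simp [hf0 s h]
    · have := (hκ.trans_le h).ne'
      simp only [max_eq_left h]
      field_simp
  rw [this]
  exact mul_mem_closedRightIdeal _ _

/-- The elements which, together with their adjoints, preserve by left multiplication every
principal closed right ideal containing `c`. It contains the unitization of the hereditary
subalgebra generated by `c`. -/
noncomputable def idealStabilizer (c : A) : StarSubalgebra ℂ A where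
  carrier := {u | ∀ d, c ∈ closedRightIdeal d → ∀ y ∈ closedRightIdeal d,
    u * y ∈ closedRightIdeal d ∧ star u * y ∈ closedRightIdeal d}
  mul_mem' {u v} hu hv d hd y hy := by
    rw [star_mul, mul_assoc, mul_assoc]
    exact ⟨(hu d hd _ (hv d hd y hy).1).1, (hv d hd _ (hu d hd y hy).2).2⟩
  add_mem' {u v} hu hv d hd y hy := by
    rw [star_add, add_mul, add_mul]
    exact ⟨add_mem (hu d hd y hy).1 (hv d hd y hy).1, add_mem (hu d hd y hy).2 (hv d hd y hy).2⟩
  algebraMap_mem' r d hd y hy := by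
    rw [← algebraMap_star_comm, ← Algebra.smul_def, ← Algebra.smul_def]
    exact ⟨Submodule.smul_mem _ _ hy, Submodule.smul_mem _ _ hy⟩
  star_mem' {u} hu d hd y hy := by
    rw [star_star]
    exact (hu d hd y hy).symm

theorem isClosed_idealStabilizer (c : A) : IsClosed (idealStabilizer c : Set A) := by
  have : (idealStabilizer c : Set A) = ⋂ (d : A) (_ : c ∈ closedRightIdeal d)
      (y : A) (_ : y ∈ closedRightIdeal d),
      {u | u * y ∈ closedRightIdeal d} ∩ {u | star u * y ∈ closedRightIdeal d} := by
    ext u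
    simp [idealStabilizer, ← SetLike.mem_coe]
  rw [this]
  refine isClosed_iInter fun d ↦ isClosed_iInter fun _ ↦ isClosed_iInter fun y ↦
    isClosed_iInter fun _ ↦ ?_
  exact ((isClosed_closedRightIdeal d).preimage (f := fun u : A ↦ u * y) (by fun_prop)).inter
    ((isClosed_closedRightIdeal d).preimage (f := fun u : A ↦ star u * y) (by fun_prop))

theorem mem_idealStabilizer {c x : A} (hx : x ∈ closedRightIdeal c)
    (hx' : star x ∈ closedRightIdeal c) : x ∈ idealStabilizer c := fun _ hd y _ ↦
  ⟨mul_right_mem_closedRightIdeal (closedRightIdeal_le hd hx) y,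
    mul_right_mem_closedRightIdeal (closedRightIdeal_le hd hx') y⟩

end ClosedRightIdeal

section Positive

variable {A : Type*} [CStarAlgebra A] [PartialOrder A] [StarOrderedRing A]

/-- An approximate left unit for the closed right ideal generated by a positive element. -/
theorem exists_approx_unit_closedRightIdeal {c : A} (hc : 0 ≤ c) {z : A}
    (hz : z ∈ closedRightIdeal c) {ε : ℝ} (hε : 0 < ε) :
    ∃ w ∈ closedRightIdeal c, star w = w ∧ ‖w * z - z‖ < ε := by
  have hcsa : IsSelfAdjoint c := .of_nonneg hc
  have hz' : z ∈ closure (LinearMap.range (LinearMap.mulLeft ℂ c) : Set A) := hz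
  obtain ⟨_, ⟨m, rfl⟩, hm⟩ := Metric.mem_closure_iff.1 hz' (ε / 4) (by positivity)
  rw [LinearMap.mulLeft_apply, dist_eq_norm] at hm
  set τ : ℝ := ε / (4 * (‖m‖ + 1)) with hτdef
  have hτ : 0 < τ := by positivity
  have hmax (s : ℝ) : max s τ ≠ 0 := (lt_max_of_lt_right hτ).ne'
  have hg : Continuous fun s : ℝ ↦ (max s τ)⁻¹ := by fun_prop (disch := exact hmax _)
  have hpos : ∀ s ∈ spectrum ℝ c, 0 ≤ s := fun s hs ↦ spectrum_nonneg_of_nonneg hc hs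
  set w : A := cfc (fun s : ℝ ↦ s * (max s τ)⁻¹) c with hw
  have hwc : w = c * cfc (fun s : ℝ ↦ (max s τ)⁻¹) c := by
    rw [hw, cfc_mul _ _ _ (by fun_prop) hg.continuousOn, cfc_id' ℝ c]
  have hw1 : ‖w‖ ≤ 1 := by
    refine norm_cfc_le zero_le_one fun s hs ↦ ?_
    have h0 := hpos s hs
    have hm0 : 0 < max s τ := lt_max_of_lt_right hτ
    rw [Real.norm_of_nonneg (by positivity), ← div_eq_mul_inv, div_le_one hm0]
    exact le_max_left _ _
  have hw2 : ‖w * c - c‖ ≤ τ := by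
    have : w * c - c = cfc (fun s : ℝ ↦ s * (max s τ)⁻¹ * s - s) c := by
      rw [cfc_sub _ _ _ (by fun_prop) (by fun_prop), cfc_mul _ _ _ (by fun_prop) (by fun_prop),
        cfc_id' ℝ c]
    rw [this]
    refine norm_cfc_le hτ.le fun s hs ↦ ?_
    have h0 := hpos s hs
    rcases le_total s τ with h | h
    · rw [max_eq_right h, Real.norm_eq_abs, abs_le]
      have h1 : s * τ⁻¹ ≤ 1 := by rwa [← div_eq_mul_inv, div_le_one hτ]
      have h2 : 0 ≤ s * τ⁻¹ := by positivity
      constructor <;> nlinarith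
    · have : s ≠ 0 := (hτ.trans_le h).ne'
      rw [max_eq_left h, mul_inv_cancel₀ this]
      simpa using hτ.le
  refine ⟨w, hwc ▸ mul_mem_closedRightIdeal _ _, IsSelfAdjoint.star_eq IsSelfAdjoint.cfc, ?_⟩
  have hsplit : w * z - z = w * (z - c * m) + (w * c - c) * m - (z - c * m) := by noncomm_ring
  have h1 : ‖w * (z - c * m)‖ ≤ ε / 4 :=
    (norm_mul_le _ _).trans (by nlinarith [norm_nonneg (z - c * m), norm_nonneg w])
  have h2 : ‖(w * c - c) * m‖ ≤ ε / 4 := by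
    refine (norm_mul_le _ _).trans ((mul_le_mul_of_nonneg_right hw2 (norm_nonneg m)).trans ?_)
    rw [hτdef, div_mul_eq_mul_div, div_le_div_iff₀ (by positivity) (by positivity)]
    nlinarith [norm_nonneg m]
  rw [hsplit]
  calc _ ≤ ‖w * (z - c * m)‖ + ‖(w * c - c) * m‖ + ‖z - c * m‖ :=
        (norm_sub_le _ _).trans (by gcongr; exact norm_add_le _ _)
    _ < ε := by linarith

theorem cfc_sqrt_mem_closedRightIdeal {c : A} (hc : 0 ≤ c) :
    cfc Real.sqrt c ∈ closedRightIdeal c := by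
  have hcsa : IsSelfAdjoint c := .of_nonneg hc
  rw [← SetLike.mem_coe, ← (isClosed_closedRightIdeal c).closure_eq, Metric.mem_closure_iff]
  intro ε hε
  set f : ℝ → ℝ := fun s ↦ max (Real.sqrt s - ε / 2) 0
  have hf : Continuous f := by fun_prop
  refine ⟨cfc f c, cfc_mem_closedRightIdeal hcsa (κ := (ε / 2) ^ 2) (by positivity) hf ?_, ?_⟩
  · intro s hs
    have : Real.sqrt s ≤ ε / 2 := Real.sqrt_le_iff.2 ⟨by positivity, hs⟩
    simpa [f] using this
  · rw [dist_eq_norm, ← cfc_sub _ _ _ (by fun_prop) hf.continuousOn]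
    refine (norm_cfc_le (c := ε / 2) (by positivity) fun s _ ↦ ?_).trans_lt (by linarith)
    have := Real.sqrt_nonneg s
    rw [Real.norm_eq_abs, abs_le]
    rcases le_total (Real.sqrt s) (ε / 2) with h | h
    · simp only [f, max_eq_right (sub_nonpos.2 h)]
      constructor <;> linarith
    · simp only [f, max_eq_left (sub_nonneg.2 h)]
      constructor <;> linarith

/-- Stable rank one passes to the unitizations of hereditary subalgebras. -/
theorem mem_closure_isUnit_idealStabilizer (hA : Dense {x : A | IsUnit x}) {c : A} (hc : 0 ≤ c)
    (z : idealStabilizer c) (hz : (z : A) ∈ closedRightIdeal c)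
    (hz' : star (z : A) ∈ closedRightIdeal c) :
    z ∈ closure {y : idealStabilizer c | IsUnit y} := by
  have : IsClosed (idealStabilizer c : Set A) := isClosed_idealStabilizer c
  rw [Metric.mem_closure_iff]
  intro ε hε
  obtain ⟨w, hw, hwsa, hwz⟩ := exists_approx_unit_closedRightIdeal hc hz (ε := ε / 3)
    (by positivity)
  obtain ⟨l, hl0, hl⟩ : ∃ l : ℂ, l ≠ 0 ∧ ‖algebraMap ℂ A l‖ < ε / 3 := by
    have h1 : Tendsto (fun l : ℂ ↦ ‖algebraMap ℂ A l‖) (𝓝[≠] 0) (𝓝 0) := by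
      have : Continuous fun l : ℂ ↦ ‖algebraMap ℂ A l‖ := by fun_prop
      simpa using (this.tendsto 0).mono_left (nhdsWithin_le_nhds (s := {0}ᶜ))
    have h2 := (h1.eventually_lt_const (show (0 : ℝ) < ε / 3 by positivity)).and
      self_mem_nhdsWithin
    obtain ⟨l, h, h'⟩ := h2.exists
    exact ⟨l, h', h⟩
  obtain ⟨e, hye, h1, h2⟩ : ∃ e : A, IsUnit (1 + l⁻¹ • ((z : A) * w) + e) ∧ IsUnit (1 + e) ∧
      ‖w * Ring.inverse (1 + e) * z - w * z‖ < ε / 3 := by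
    have hinv : ContinuousAt (fun e : A ↦ Ring.inverse (1 + e)) 0 := by
      have := NormedRing.inverse_continuousAt (1 : Aˣ)
      refine ContinuousAt.comp (g := Ring.inverse) ?_ (by fun_prop)
      simpa using this
    have hE : ContinuousAt (fun e : A ↦ ‖w * Ring.inverse (1 + e) * z - w * z‖) 0 := by fun_prop
    have hE' : ContinuousAt (fun e : A ↦ 1 + e) 0 := by fun_prop
    have hU : {y : A | IsUnit y} ∈ 𝓝 (1 : A) := Units.isOpen.mem_nhds isUnit_one
    have hU1 : ∀ᶠ e in 𝓝 (0 : A), IsUnit (1 + e) :=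
      hE'.eventually (p := IsUnit) (by simpa using! hU)
    have hU2 : ∀ᶠ e in 𝓝 (0 : A), ‖w * Ring.inverse (1 + e) * z - w * z‖ < ε / 3 :=
      hE.eventually_lt_const (by simpa using hε)
    set y₀ : A := 1 + l⁻¹ • ((z : A) * w)
    have hfr : ∃ᶠ y in 𝓝 y₀, IsUnit y := mem_closure_iff_frequently.1 (hA y₀)
    have ht : Tendsto (fun y : A ↦ y - y₀) (𝓝 y₀) (𝓝 0) := by
      have : ContinuousAt (fun y : A ↦ y - y₀) y₀ := by fun_prop
      simpa [ContinuousAt] using this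
    obtain ⟨y, hy, hy'⟩ := (hfr.and_eventually (ht.eventually (hU1.and hU2))).exists
    exact ⟨y - y₀, by simpa using hy, hy'⟩
  obtain ⟨v, hv⟩ := h1
  rw [← hv, Ring.inverse_unit] at h2
  have hu1 : IsUnit (1 + (l⁻¹ • (↑v⁻¹ * (z : A))) * w) := by
    have : 1 + (l⁻¹ • (↑v⁻¹ * (z : A))) * w = ↑v⁻¹ * (1 + l⁻¹ • ((z : A) * w) + e) := by
      rw [Units.eq_inv_mul_iff_mul_eq, mul_add, smul_mul_assoc, mul_smul_comm, mul_assoc,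
        Units.mul_inv_cancel_left, hv]
      simp only [mul_one]
      abel
    rw [this]
    exact v⁻¹.isUnit.mul hye
  have hu2 : IsUnit (1 + w * (l⁻¹ • (↑v⁻¹ * (z : A)))) := isUnit_one_add_mul_swap hu1
  set y : A := algebraMap ℂ A l + w * ↑v⁻¹ * z with hy
  have hyu : IsUnit y := by
    have : y = algebraMap ℂ A l * (1 + w * (l⁻¹ • (↑v⁻¹ * (z : A)))) := by
      rw [hy, mul_add, mul_one, ← Algebra.smul_def, mul_smul_comm, smul_smul,
        mul_inv_cancel₀ hl0, one_smul, mul_assoc]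
    rw [this]
    exact ((isUnit_iff_ne_zero.2 hl0).map (algebraMap ℂ A)).mul hu2
  have hyS : y ∈ idealStabilizer c := by
    refine add_mem (algebraMap_mem _ l) (mem_idealStabilizer ?_ ?_)
    · rw [mul_assoc]
      exact mul_right_mem_closedRightIdeal hw _
    · rw [star_mul]
      exact mul_right_mem_closedRightIdeal hz' _
  refine ⟨⟨y, hyS⟩, (idealStabilizer c).coe_isUnit.1 hyu, ?_⟩
  rw [Subtype.dist_eq, dist_comm, dist_eq_norm]
  have : y - z = algebraMap ℂ A l + (w * ↑v⁻¹ * z - w * z) + (w * z - z) := by rw [hy]; abel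
  rw [this]
  calc _ ≤ ‖algebraMap ℂ A l‖ + ‖w * ↑v⁻¹ * z - w * z‖ + ‖w * z - z‖ :=
        (norm_add_le _ _).trans (by gcongr; exact norm_add_le _ _)
    _ < ε := by linarith

end Positive

section Pedersen

variable {A : Type*} [CStarAlgebra A] [PartialOrder A] [StarOrderedRing A]

theorem norm_mul_cfc_mul_le {k q : A} (hk : IsSelfAdjoint k) (hkq : k * k ≤ q)
    {φ : ℝ → ℝ} (hφ : Continuous φ) {C : ℝ} (hC : 0 ≤ C)
    (h : ∀ s, 0 ≤ s → 0 ≤ φ s ∧ s * φ s ≤ C) : ‖k * cfc φ q * k‖ ≤ C := by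
  have hq : 0 ≤ q := le_trans (by simpa [hk.star_eq] using star_mul_self_nonneg k) hkq
  have hqsa : IsSelfAdjoint q := .of_nonneg hq
  have hpos : ∀ s ∈ spectrum ℝ q, 0 ≤ s := fun s hs ↦ spectrum_nonneg_of_nonneg hq hs
  set g : A := cfc (fun s ↦ Real.sqrt (φ s)) q with hg
  have hgsa : star g = g := IsSelfAdjoint.star_eq IsSelfAdjoint.cfc
  have hgg : cfc φ q = g * g := by
    rw [hg, ← cfc_mul _ _ _ (by fun_prop) (by fun_prop)]
    exact cfc_congr fun s hs ↦ (Real.mul_self_sqrt (h s (hpos s hs)).1).symm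
  have hgq : g * q * g = cfc (fun s ↦ s * φ s) q := by
    nth_rw 1 [← cfc_id' ℝ q]
    rw [hg, ← cfc_mul _ _ _ (by fun_prop) (by fun_prop),
      ← cfc_mul _ _ _ (by fun_prop) (by fun_prop)]
    refine cfc_congr fun s hs ↦ ?_
    have := Real.mul_self_sqrt (h s (hpos s hs)).1
    linear_combination s * this
  calc ‖k * cfc φ q * k‖ = ‖star (g * k) * (g * k)‖ := by
        rw [hgg, star_mul, hk.star_eq, hgsa]; simp only [mul_assoc]
    _ = ‖(g * k) * star (g * k)‖ := by
        rw [CStarRing.norm_star_mul_self, CStarRing.norm_self_mul_star]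
    _ = ‖g * (k * k) * g‖ := by rw [star_mul, hk.star_eq, hgsa]; simp only [mul_assoc]
    _ ≤ ‖g * q * g‖ := by
        refine CStarAlgebra.norm_le_norm_of_nonneg_of_le ?_ ?_
        · have := star_mul_self_nonneg (k * g)
          rw [star_mul, hk.star_eq, hgsa] at this
          simpa only [mul_assoc] using this
        · have := star_left_conjugate_le_conjugate hkq g
          rwa [hgsa] at this
    _ ≤ C := by
        rw [hgq]
        refine norm_cfc_le hC fun s hs ↦ ?_
        rw [Real.norm_of_nonneg (mul_nonneg (hpos s hs) (h s (hpos s hs)).1)]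
        exact (h s (hpos s hs)).2

/-- If `k² ≤ z₀⋆z₀` then `k²` is of the form `z⋆z` with `z` in the closed right ideal of `z₀`. -/
theorem exists_star_mul_self_eq_of_le {k z₀ : A} (hk : IsSelfAdjoint k)
    (hkz : k * k ≤ star z₀ * z₀) : ∃ z ∈ closedRightIdeal z₀,
      star z ∈ closedRightIdeal k ∧ star z * z = k * k := by
  set q : A := star z₀ * z₀ with hq
  have hqsa : IsSelfAdjoint q := .star_mul_self z₀
  set e : ℕ → ℝ := fun n ↦ 1 / ((n : ℝ) + 1) with he
  have he0 (n) : 0 < e n := by simp only [he]; positivity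
  have hlim : Tendsto e atTop (𝓝 0) := tendsto_one_div_add_atTop_nhds_zero_nat
  set g : ℕ → ℝ → ℝ := fun n s ↦ (Real.sqrt (max s 0 + e n))⁻¹ with hg
  have hpos (n) (s : ℝ) : 0 < max s 0 + e n := add_pos_of_nonneg_of_pos (le_max_right _ _) (he0 n)
  have hgc (n) : Continuous (g n) := by
    have hne (s : ℝ) : Real.sqrt (max s 0 + e n) ≠ 0 := (Real.sqrt_pos.2 (hpos n s)).ne'
    fun_prop (disch := exact hne _)
  set z : ℕ → A := fun n ↦ z₀ * cfc (g n) q * k with hz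
  have hcfc (f : ℝ → ℝ) (hf : Continuous f) :
      star (z₀ * cfc f q * k) * (z₀ * cfc f q * k) = k * cfc (fun s ↦ f s * s * f s) q * k := by
    have hsa : star (cfc f q) = cfc f q := IsSelfAdjoint.star_eq IsSelfAdjoint.cfc
    rw [cfc_mul _ _ _ (by fun_prop) (by fun_prop), cfc_mul _ _ _ (by fun_prop) (by fun_prop),
      cfc_id' ℝ q, star_mul, star_mul, hsa, hk.star_eq, hq]
    simp only [mul_assoc]
  have hdiff (n m : ℕ) (hnm : n ≤ m) : ‖z n - z m‖ ^ 2 ≤ e n := by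
    have h1 : z n - z m = z₀ * cfc (fun s ↦ g n s - g m s) q * k := by
      rw [cfc_sub _ _ _ (hgc n).continuousOn (hgc m).continuousOn, hz]
      simp only [mul_sub, sub_mul]
    rw [sq, ← CStarRing.norm_star_mul_self, h1,
      hcfc (fun s ↦ g n s - g m s) ((hgc n).sub (hgc m))]
    refine norm_mul_cfc_mul_le hk hkz (by fun_prop) (he0 n).le fun s hs ↦ ⟨?_, ?_⟩
    · rw [mul_right_comm]
      exact mul_nonneg (mul_self_nonneg _) hs
    · have hem : e m ≤ e n := one_div_le_one_div_of_le (by positivity) (by gcongr)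
      have hm0 : max s 0 = s := max_eq_left hs
      simp only [hg, hm0]
      have pm : 0 < s + e m := by linarith [he0 m]
      have pn : 0 < s + e n := by linarith [he0 n]
      have hm := Real.sq_sqrt pm.le
      have hn := Real.sq_sqrt pn.le
      have hm' := Real.sqrt_pos.2 pm
      have hn' := Real.sqrt_pos.2 pn
      have hle : Real.sqrt (s + e m) ≤ Real.sqrt (s + e n) := Real.sqrt_le_sqrt (by linarith)
      set α := Real.sqrt (s + e m)
      set β := Real.sqrt (s + e n)
      have h2 : β⁻¹ ≤ α⁻¹ := inv_anti₀ hm' hle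
      have h3 : s * ((β⁻¹ - α⁻¹) * s * (β⁻¹ - α⁻¹)) ≤ s ^ 2 * (α⁻¹ ^ 2 - β⁻¹ ^ 2) := by
        have : 0 ≤ β⁻¹ := by positivity
        nlinarith [mul_nonneg (sq_nonneg s) (mul_nonneg this (sub_nonneg.2 h2))]
      refine h3.trans ?_
      rw [inv_pow, inv_pow, hm, hn, inv_sub_inv pm.ne' pn.ne', ← mul_div_assoc,
        div_le_iff₀ (by positivity)]
      have := he0 m
      have := he0 n
      nlinarith [mul_nonneg hs this.le, mul_nonneg hs (he0 m).le, mul_pos (he0 m) this,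
        mul_nonneg (sq_nonneg s) (he0 m).le, mul_nonneg hs (mul_pos (he0 m) this).le,
        mul_nonneg (mul_nonneg hs this.le) this.le, mul_nonneg (mul_pos this this).le (he0 m).le]
  have hcauchy : CauchySeq z := by
    refine cauchySeq_of_le_tendsto_0 (fun n ↦ 2 * Real.sqrt (e n)) (fun n m N hn hm ↦ ?_) ?_
    · have aux (j) (hj : N ≤ j) : dist (z N) (z j) ≤ Real.sqrt (e N) := by
        rw [dist_eq_norm]
        exact Real.le_sqrt_of_sq_le (hdiff N j hj)
      linarith [dist_triangle_left (z n) (z m) (z N), aux n hn, aux m hm]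
    · simpa using (((Real.continuous_sqrt.tendsto 0).comp hlim).const_mul 2)
  obtain ⟨w, hw⟩ := cauchySeq_tendsto_of_complete hcauchy
  refine ⟨w, ?_, ?_, ?_⟩
  · refine (isClosed_closedRightIdeal z₀).mem_of_tendsto hw (Eventually.of_forall fun n ↦ ?_)
    simp only [hz, mul_assoc]
    exact mul_mem_closedRightIdeal _ _
  · refine (isClosed_closedRightIdeal k).mem_of_tendsto hw.star (Eventually.of_forall fun n ↦ ?_)
    simp only [hz, star_mul, hk.star_eq]
    exact mul_mem_closedRightIdeal _ _
  · refine tendsto_nhds_unique (hw.star.mul hw) ?_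
    rw [tendsto_iff_norm_sub_tendsto_zero]
    refine squeeze_zero (fun _ ↦ norm_nonneg _) (fun n ↦ ?_) hlim
    have hc1 : Continuous fun s ↦ g n s * s * g n s := by have := hgc n; fun_prop
    have h1 : star (z n) * z n - k * k = -(k * cfc (fun s ↦ 1 - g n s * s * g n s) q * k) := by
      rw [hz, hcfc _ (hgc n), cfc_sub _ _ _ (by fun_prop) hc1.continuousOn, cfc_const_one ℝ q]
      noncomm_ring
    rw [h1, norm_neg]
    refine norm_mul_cfc_mul_le hk hkz (by fun_prop) (he0 n).le fun s hs ↦ ?_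
    have pn : 0 < s + e n := by linarith [he0 n]
    have h2 : g n s * s * g n s = s / (s + e n) := by
      simp only [hg, max_eq_left hs]
      rw [mul_right_comm, ← mul_inv, Real.mul_self_sqrt pn.le]
      field_simp
    have h3 : 1 - s / (s + e n) = e n / (s + e n) := by field_simp; ring
    rw [h2, h3]
    refine ⟨by have := he0 n; positivity, ?_⟩
    rw [← mul_div_assoc, div_le_iff₀ pn]
    nlinarith [he0 n]

end Pedersen

/-- The element `(x - t)₊`. -/
noncomputable def cutdown {A : Type*} [CStarAlgebra A] (x : A) (t : ℝ) : A :=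
  cfc (fun s : ℝ ↦ max (s - t) 0) x

section Cutdown

variable {A : Type*} [CStarAlgebra A]

theorem isSelfAdjoint_cutdown (x : A) (t : ℝ) : IsSelfAdjoint (cutdown x t) := IsSelfAdjoint.cfc

theorem cutdown_cutdown {x : A} (hx : IsSelfAdjoint x) {s t : ℝ} (ht : 0 ≤ t) :
    cutdown (cutdown x s) t = cutdown x (s + t) := by
  rw [cutdown, cutdown, cutdown, ← cfc_comp' _ _ x (by fun_prop) (by fun_prop)]
  refine cfc_congr fun r _ ↦ ?_
  rcases le_total (r - s) 0 with h | h
  · rw [max_eq_right h, max_eq_right (by linarith), max_eq_right (by linarith)]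
  · rw [max_eq_left h, sub_sub]

theorem cutdown_mem_closedRightIdeal {x : A} (hx : IsSelfAdjoint x) {t : ℝ} (ht : 0 < t) :
    cutdown x t ∈ closedRightIdeal x :=
  cfc_mem_closedRightIdeal hx ht (by fun_prop) fun s hs ↦ max_eq_right (by linarith)

theorem unitary_conj_cfc {u : A} (hu : u ∈ unitary A) {x : A} (hx : IsSelfAdjoint x) {f : ℝ → ℝ}
    (hf : Continuous f) : u * cfc f x * star u = cfc f (u * x * star u) := by
  have := StarAlgHomClass.map_cfc (R := ℝ) (S := ℝ) (Unitary.conjStarAlgAut ℝ A ⟨u, hu⟩) f x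
    (by fun_prop) (by change Continuous fun y ↦ u * y * star u; fun_prop) hx
    (by simpa [Unitary.conjStarAlgAut_apply] using hx.conjugate u)
  simpa [Unitary.conjStarAlgAut_apply] using this

theorem unitary_conj_cutdown {u : A} (hu : u ∈ unitary A) {x : A} (hx : IsSelfAdjoint x) (t : ℝ) :
    u * cutdown x t * star u = cutdown (u * x * star u) t :=
  unitary_conj_cfc hu hx (by fun_prop)

theorem cutdown_nonneg [PartialOrder A] [StarOrderedRing A] (x : A) (t : ℝ) : 0 ≤ cutdown x t :=
  cfc_nonneg fun _ _ ↦ le_max_right _ _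

theorem CuntzSubequivalent.unitary_conj {x y : A} (h : CuntzSubequivalent x y) {u v : A}
    (hv : v ∈ unitary A) :
    CuntzSubequivalent (u * x * star u) (v * y * star v) := by
  obtain ⟨d, hd⟩ := h
  refine ⟨fun n ↦ u * d n * star v, ?_⟩
  have : Tendsto (fun n ↦ u * (d n * y * star (d n)) * star u) atTop (𝓝 (u * x * star u)) :=
    (hd.const_mul u).mul_const (star u)
  refine this.congr fun n ↦ ?_
  simp only [star_mul, star_star, mul_assoc]
  simp only [Unitary.star_mul_self_of_mem hv, ← mul_assoc (star v) v, one_mul]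

end Cutdown

/-- A unitary moving a cutdown of `x` into the closed right ideal generated by `y`. -/
theorem exists_unitary_conj_cutdown_mem {A : Type*} [CStarAlgebra A] [PartialOrder A]
    [StarOrderedRing A] (hA : Dense {x : A | IsUnit x}) {c x y : A} (hc : 0 ≤ c) (hx : 0 ≤ x)
    (hy : 0 ≤ y) (hxc : x ∈ closedRightIdeal c) (hyc : y ∈ closedRightIdeal c)
    (hxy : CuntzSubequivalent x y) {δ : ℝ} (hδ : 0 < δ) :
    ∃ v ∈ unitary A, v ∈ idealStabilizer c ∧ v * cutdown x δ * star v ∈ closedRightIdeal y := by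
  have hxsa : IsSelfAdjoint x := .of_nonneg hx
  have hysa : IsSelfAdjoint y := .of_nonneg hy
  obtain ⟨d, hd⟩ : ∃ d : A, ‖d * y * star d - x‖ < δ / 2 := by
    obtain ⟨d, hd⟩ := hxy
    rw [tendsto_iff_norm_sub_tendsto_zero] at hd
    obtain ⟨n, hn⟩ := (hd.eventually_lt_const (half_pos hδ)).exists
    exact ⟨d n, hn⟩
  set p : A := d * y * star d with hp
  set f : A := cfc (fun s : ℝ ↦ Real.sqrt (max (s - δ / 2) 0)) x with hf
  have hfsa : star f = f := IsSelfAdjoint.star_eq IsSelfAdjoint.cfc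
  set k : A := cutdown x (δ / 2) with hk
  have hksa : IsSelfAdjoint k := isSelfAdjoint_cutdown _ _
  set r : A := cfc Real.sqrt y with hr
  have hrsa : star r = r := IsSelfAdjoint.star_eq IsSelfAdjoint.cfc
  have hrr : r * r = y := by
    rw [hr, ← cfc_mul _ _ _ (by fun_prop) (by fun_prop)]
    nth_rw 2 [← cfc_id' ℝ y]
    exact cfc_congr fun s hs ↦ Real.mul_self_sqrt (spectrum_nonneg_of_nonneg hy hs)
  set z₀ : A := r * star d * f with hz₀
  have hz₀z₀ : star z₀ * z₀ = f * p * f := by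
    rw [hz₀, hp, ← hrr]
    simp only [star_mul, star_star, hfsa, hrsa, mul_assoc]
  have hle : x - algebraMap ℝ A (δ / 2) ≤ p := by
    have hpsa : IsSelfAdjoint p := hysa.conjugate d
    have h1 : x - p ≤ algebraMap ℝ A ‖x - p‖ := (hxsa.sub hpsa).le_algebraMap_norm_self
    have h2 : algebraMap ℝ A ‖x - p‖ ≤ algebraMap ℝ A (δ / 2) := by
      refine algebraMap_mono A ?_
      rw [norm_sub_rev]
      exact hd.le
    have := h1.trans h2
    rw [sub_le_iff_le_add] at this ⊢
    rwa [add_comm]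
  have hkz : k * k ≤ star z₀ * z₀ := by
    have h1 := star_left_conjugate_le_conjugate hle f
    rw [hfsa] at h1
    rw [hz₀z₀]
    refine le_of_eq_of_le ?_ h1
    have h2 : x - algebraMap ℝ A (δ / 2) = cfc (fun s : ℝ ↦ s - δ / 2) x := by
      rw [cfc_sub _ _ _ (by fun_prop) (by fun_prop), cfc_id' ℝ x, cfc_const _ x]
    rw [h2, hk, hf, cutdown, ← cfc_mul _ _ _ (by fun_prop) (by fun_prop),
      ← cfc_mul _ _ _ (by fun_prop) (by fun_prop), ← cfc_mul _ _ _ (by fun_prop) (by fun_prop)]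
    refine cfc_congr fun s _ ↦ ?_
    rw [mul_right_comm, Real.mul_self_sqrt (le_max_right _ _)]
    rcases le_total (s - δ / 2) 0 with h | h
    · simp [max_eq_right h]
    · simp [max_eq_left h]
  obtain ⟨z, hz, hz', hzz⟩ := exists_star_mul_self_eq_of_le hksa hkz
  have hzy : z ∈ closedRightIdeal y := by
    refine closedRightIdeal_le (cfc_sqrt_mem_closedRightIdeal hy) (closedRightIdeal_le ?_ hz)
    rw [hz₀, mul_assoc]
    exact mul_mem_closedRightIdeal _ _
  have hzc : z ∈ closedRightIdeal c := closedRightIdeal_le hyc hzy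
  have hzc' : star z ∈ closedRightIdeal c := closedRightIdeal_le hxc
    (closedRightIdeal_le (cutdown_mem_closedRightIdeal hxsa (half_pos hδ)) hz')
  have hcl : IsClosed (idealStabilizer c : Set A) := isClosed_idealStabilizer c
  set Φ : ℝ → ℝ := fun s ↦ max (Real.sqrt s - δ / 2) 0 with hΦdef
  have hΦ : Continuous Φ := by fun_prop
  have hΦ0 : ∀ s ≤ (δ / 2) ^ 2, Φ s = 0 := fun s hs ↦ by
    have : Real.sqrt s ≤ δ / 2 := Real.sqrt_le_iff.2 ⟨by positivity, hs⟩
    simpa [hΦdef] using this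
  have hκ : 0 < (δ / 2) ^ 2 := by positivity
  let ζ : idealStabilizer c := ⟨z, mem_idealStabilizer hzc hzc'⟩
  obtain ⟨w, hw, hwζ⟩ := exists_unitary_conj_cfc
    (mem_closure_isUnit_idealStabilizer hA hc ζ hzc hzc') hκ hΦ hΦ0
  have hsub (q : idealStabilizer c) (hq : IsSelfAdjoint q) :
      ((cfc Φ q : idealStabilizer c) : A) = cfc Φ (q : A) :=
    StarAlgHom.map_cfc (R := ℝ) (S := ℂ) (idealStabilizer c).subtype Φ q
      (by fun_prop) continuous_subtype_val hq (hq.map (idealStabilizer c).subtype)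
  refine ⟨w, ?_, w.2, ?_⟩
  · exact Unitary.map_mem (idealStabilizer c).subtype hw
  · have hcut : cfc Φ (star z * z) = cutdown x δ := by
      rw [hzz, hk, cutdown, ← cfc_mul _ _ _ (by fun_prop) (by fun_prop), cutdown,
        ← cfc_comp' _ _ x (by fun_prop) (by fun_prop)]
      refine cfc_congr fun s _ ↦ ?_
      simp only [hΦdef]
      rw [Real.sqrt_mul_self (le_max_right _ _)]
      rcases le_total (s - δ / 2) 0 with h | h
      · rw [max_eq_right h, max_eq_right (by linarith), max_eq_right (by linarith)]
      · rw [max_eq_left h, sub_sub, add_halves]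
    have : (w : A) * cutdown x δ * star (w : A) = cfc Φ (z * star z) := by
      rw [← hcut]
      have h1 := hsub (star ζ * ζ) (.star_mul_self ζ)
      have h2 := hsub (ζ * star ζ) (.mul_star_self ζ)
      have h3 := congrArg (Subtype.val) hwζ
      rw [h2] at h3
      simp only [MulMemClass.coe_mul, h1] at h3
      exact h3
    rw [this]
    refine closedRightIdeal_le hzy (closedRightIdeal_le (mul_mem_closedRightIdeal z (star z)) ?_)
    exact cfc_mem_closedRightIdeal (.mul_star_self z) hκ hΦ hΦ0

/-- The cutdown of `p false` or `p true`, according to the parity of `i`, at level `(i + 1) η`. -/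
noncomputable def chainTerm {A : Type*} [CStarAlgebra A] (p : Bool → A) (η : ℝ) (i : ℕ) : A :=
  cutdown (p i.bodd) ((i + 1) * η)

section Chain

variable {A : Type*} [CStarAlgebra A]

theorem unitary_conj_mem_closedRightIdeal {c v x : A} (hvc : v ∈ idealStabilizer c)
    (hx : c ∈ closedRightIdeal x) : v * x * star v ∈ closedRightIdeal x :=
  mul_right_mem_closedRightIdeal (hvc x hx x (self_mem_closedRightIdeal x)).1 _

theorem mem_closedRightIdeal_unitary_conj {c v x : A} (hv : v ∈ unitary A)
    (hvc : v ∈ idealStabilizer c) (hx : c ∈ closedRightIdeal x) :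
    x ∈ closedRightIdeal (v * x * star v) := by
  have h1 := mul_left_mem_closedRightIdeal (hvc x hx x (self_mem_closedRightIdeal x)).2 v
  rw [← mul_assoc, Unitary.mul_star_self_of_mem hv, one_mul] at h1
  refine closedRightIdeal_le ?_ h1
  have h2 := mul_mem_closedRightIdeal (v * x * star v) v
  rwa [mul_assoc _ (star v), Unitary.star_mul_self_of_mem hv, mul_one] at h2

theorem mem_closedRightIdeal_of_chain {X : ℕ → A} {n : ℕ}
    (h : ∀ i < n, X (i + 1) ∈ closedRightIdeal (X i)) {i j : ℕ} (hij : i ≤ j) (hj : j ≤ n) :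
    X j ∈ closedRightIdeal (X i) := by
  induction j, hij using Nat.le_induction with
  | base => exact self_mem_closedRightIdeal _
  | succ j _ ih => exact closedRightIdeal_le (ih (by omega)) (h j (by omega))

/-- Up to unitary equivalence, the cutdowns of two elements with Cuntz equivalent cutdowns
generate a decreasing interlaced chain of closed right ideals. -/
theorem exists_chain [PartialOrder A] [StarOrderedRing A] (hA : Dense {x : A | IsUnit x})
    {α : Bool → A} (hα : ∀ β, IsSelfAdjoint (α β))
    (hcut : ∀ β, ∀ t > 0, CuntzSubequivalent (cutdown (α β) t) (cutdown (α !β) t))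
    {η : ℝ} (hη : 0 < η) (n : ℕ) :
    ∃ p : Bool → A, (∀ β, ∃ u ∈ unitary A, p β = u * α β * star u) ∧
      ∀ i < n, chainTerm p η (i + 1) ∈ closedRightIdeal (chainTerm p η i) := by
  induction n with
  | zero => exact ⟨α, fun β ↦ ⟨1, one_mem _, by simp⟩, by simp⟩
  | succ n ih =>
    obtain ⟨p, hp, hchain⟩ := ih
    have hsa (β) : IsSelfAdjoint (p β) := by
      obtain ⟨u, -, hu⟩ := hp β
      exact hu ▸ (hα β).conjugate u
    set X : ℕ → A := chainTerm p η with hX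
    set β : Bool := (n + 1).bodd with hβ
    have hβn : n.bodd = !β := by simp [hβ]
    set x : A := cutdown (p β) ((n + 1) * η) with hx
    have hxX : cutdown x η = X (n + 1) := by
      rw [hx, cutdown_cutdown (hsa _) hη.le, hX, chainTerm]
      push_cast
      congr 1
      ring
    obtain ⟨c, hc, hxc, hyc, hcX⟩ : ∃ c : A, 0 ≤ c ∧ x ∈ closedRightIdeal c ∧
        X n ∈ closedRightIdeal c ∧ ∀ i < n, c ∈ closedRightIdeal (X i) := by
      rcases n with _ | m
      · refine ⟨1, zero_le_one, ?_, ?_, by simp⟩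
        · simpa using mul_mem_closedRightIdeal 1 x
        · simpa using mul_mem_closedRightIdeal 1 (X 0)
      · refine ⟨X m, cutdown_nonneg _ _, ?_, hchain m (by omega), fun i hi ↦
          mem_closedRightIdeal_of_chain hchain (by omega) (by omega)⟩
        have : x = cutdown (X m) η := by
          rw [hX, chainTerm, cutdown_cutdown (hsa _) hη.le, hx, hβ]
          push_cast
          simp only [Nat.bodd_succ, Bool.not_not]
          congr 1
          ring
        rw [this]
        exact cutdown_mem_closedRightIdeal (isSelfAdjoint_cutdown _ _) hη
    have hxy : CuntzSubequivalent x (X n) := by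
      obtain ⟨u, hu, hpu⟩ := hp β
      obtain ⟨w, hw, hpw⟩ := hp (!β)
      have := (hcut β ((n + 1) * η) (by positivity)).unitary_conj (u := u) hw
      rwa [unitary_conj_cutdown hu (hα _), unitary_conj_cutdown hw (hα _), ← hpu, ← hpw, ← hβn]
        at this
    obtain ⟨v, hv, hvc, hvX⟩ := exists_unitary_conj_cutdown_mem hA hc (cutdown_nonneg _ _)
      (cutdown_nonneg _ _) hxc hyc hxy hη
    rw [hxX] at hvX
    set p' : Bool → A := Function.update p β (v * p β * star v) with hp'
    have hX'₁ (i : ℕ) (hi : i.bodd = β) : chainTerm p' η i = v * X i * star v := by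
      rw [hX, chainTerm, chainTerm, hi, unitary_conj_cutdown hv (hsa _), hp', Function.update_self]
    have hX'₂ (i : ℕ) (hi : i.bodd ≠ β) : chainTerm p' η i = X i := by
      rw [hX, chainTerm, chainTerm, hp', Function.update_of_ne hi]
    have hn : chainTerm p' η n = X n := hX'₂ n (by simp [hβn])
    have hle (i : ℕ) (hi : i ≤ n) : chainTerm p' η i ∈ closedRightIdeal (X i) := by
      rcases hi.eq_or_lt with rfl | hi
      · rw [hn]
        exact self_mem_closedRightIdeal _
      · by_cases hb : i.bodd = β
        · rw [hX'₁ i hb]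
          exact unitary_conj_mem_closedRightIdeal hvc (hcX i hi)
        · rw [hX'₂ i hb]
          exact self_mem_closedRightIdeal _
    have hge (i : ℕ) (hi : i < n) : X i ∈ closedRightIdeal (chainTerm p' η i) := by
      by_cases hb : i.bodd = β
      · rw [hX'₁ i hb]
        exact mem_closedRightIdeal_unitary_conj hv hvc (hcX i hi)
      · rw [hX'₂ i hb]
        exact self_mem_closedRightIdeal _
    refine ⟨p', fun γ ↦ ?_, fun i hi ↦ ?_⟩
    · obtain ⟨u, hu, hpu⟩ := hp γ
      by_cases hγ : γ = β
      · subst hγ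
        refine ⟨v * u, mul_mem hv hu, ?_⟩
        rw [hp', Function.update_self, hpu]
        simp only [star_mul, mul_assoc]
      · exact ⟨u, hu, by rw [hp', Function.update_of_ne hγ, hpu]⟩
    · rcases (Nat.lt_succ_iff.1 hi).eq_or_lt with rfl | hi
      · rw [hn, hX'₁ (i + 1) hβ.symm]
        exact hvX
      · exact closedRightIdeal_le (hge i hi) (closedRightIdeal_le (hchain i hi) (hle (i + 1) hi))

end Chain

section Estimate

variable {A : Type*} [CStarAlgebra A]

theorem mul_eq_self_of_mem_closedRightIdeal {e c y : A} (he : e * c = c)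
    (hy : y ∈ closedRightIdeal c) : e * y = y := by
  have hy' : y ∈ closure (LinearMap.range (LinearMap.mulLeft ℂ c) : Set A) := hy
  have hcl : IsClosed {y : A | e * y = y} := isClosed_eq (by fun_prop) (by fun_prop)
  refine closure_minimal ?_ hcl hy'
  rintro _ ⟨x, rfl⟩
  simp [← mul_assoc, he]

variable [PartialOrder A] [StarOrderedRing A]

theorem cutdown_le_cutdown_of_mem {x y : A} (hx : IsSelfAdjoint x) (hy : IsSelfAdjoint y)
    {s t δ : ℝ} (hδ : 0 < δ) (hmem : cutdown x s ∈ closedRightIdeal (cutdown y (t + δ)))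
    (hle : cutdown x (s + δ) ≤ cutdown y (t + δ)) : cutdown x s ≤ cutdown y t := by
  have hm (q : ℝ) : max q δ ≠ 0 := (lt_max_of_lt_right hδ).ne'
  have hmc (t : ℝ) : Continuous fun q ↦ δ * (max (max (q - t) 0) δ)⁻¹ :=
    continuous_const.mul (Continuous.inv₀ (by fun_prop) fun _ ↦ hm _)
  have hramp (t q : ℝ) : min (max (q - t) 0) δ =
      max (q - t) 0 * (δ * (max (max (q - t) 0) δ)⁻¹) := by
    rcases le_total (max (q - t) 0) δ with h | h
    · rw [min_eq_left h, max_eq_right h, mul_inv_cancel₀ hδ.ne', mul_one]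
    · have := (hδ.trans_le h).ne'
      rw [min_eq_right h, max_eq_left h]
      field_simp
  have hsplit (t q : ℝ) : max (q - t) 0 = min (max (q - t) 0) δ + max (q - (t + δ)) 0 := by
    grind
  have hsplit' {x : A} (hx : IsSelfAdjoint x) (t : ℝ) :
      cutdown x t = cfc (fun q ↦ min (max (q - t) 0) δ) x + cutdown x (t + δ) := by
    rw [cutdown, cutdown, ← cfc_add x _ _ (by fun_prop) (by fun_prop)]
    exact cfc_congr fun q _ ↦ hsplit t q
  rw [hsplit' hx, hsplit' hy]
  refine add_le_add ?_ hle
  set r : A := cfc (fun q ↦ min (max (q - s) 0) δ) x with hr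
  set e : A := cfc (fun q ↦ δ⁻¹ * min (max (q - t) 0) δ) y with he
  have hesa : star e = e := IsSelfAdjoint.star_eq IsSelfAdjoint.cfc
  have hrsa : star r = r := IsSelfAdjoint.star_eq IsSelfAdjoint.cfc
  have hrmem : r ∈ closedRightIdeal (cutdown y (t + δ)) := by
    refine closedRightIdeal_le hmem ?_
    have : r = cutdown x s * cfc (fun q ↦ δ * (max (max (q - s) 0) δ)⁻¹) x := by
      rw [cutdown, ← cfc_mul _ _ _ (by fun_prop) (hmc s).continuousOn, hr]
      exact cfc_congr fun q _ ↦ hramp s q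
    rw [this]
    exact mul_mem_closedRightIdeal _ _
  have her : e * r = r := by
    refine mul_eq_self_of_mem_closedRightIdeal ?_ hrmem
    rw [he, cutdown, ← cfc_mul _ _ _ (by fun_prop) (by fun_prop)]
    refine cfc_congr fun q _ ↦ ?_
    rcases le_total (q - (t + δ)) 0 with h | h
    · simp [max_eq_right h]
    · have h1 : min (max (q - t) 0) δ = δ := min_eq_right (le_max_of_le_left (by linarith))
      simp only [h1, inv_mul_cancel₀ hδ.ne', one_mul]
  have hre : r * e = r := by
    have := congrArg star her
    rwa [star_mul, hesa, hrsa] at this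
  have hrδ : r ≤ algebraMap ℝ A δ :=
    cfc_le_algebraMap _ _ _ (fun q _ ↦ min_le_right _ _) (by fun_prop)
  have h1 := star_left_conjugate_le_conjugate hrδ e
  rw [hesa, her, hre] at h1
  refine h1.trans ?_
  rw [← Algebra.commutes, mul_assoc, ← Algebra.smul_def, he,
    ← cfc_mul _ _ _ (by fun_prop) (by fun_prop), ← cfc_smul δ _ y (by fun_prop)]
  refine cfc_mono fun q _ ↦ ?_
  have h2 : 0 ≤ min (max (q - t) 0) δ := le_min (le_max_right _ _) hδ.le
  have h3 : min (max (q - t) 0) δ ≤ δ := min_le_right _ _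
  rw [smul_eq_mul, mul_assoc, mul_inv_cancel_left₀ hδ.ne', mul_left_comm, inv_mul_le_iff₀ hδ]
  nlinarith

theorem cutdown_eq_zero {x : A} (hx : 0 ≤ x) (hx1 : ‖x‖ ≤ 1) {t : ℝ} (ht : 1 ≤ t) :
    cutdown x t = 0 := by
  rw [cutdown, ← cfc_zero ℝ x]
  refine cfc_congr fun s hs ↦ max_eq_right ?_
  have := IsometricContinuousFunctionalCalculus.norm_spectrum_le x hs (.of_nonneg hx)
  rw [Real.norm_eq_abs] at this
  linarith [le_abs_self s]

theorem cutdown_le_of_chain {p : Bool → A} (hp : ∀ β, 0 ≤ p β) (hp1 : ∀ β, ‖p β‖ ≤ 1) {η : ℝ}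
    (hη : 0 < η) {N : ℕ} (hN : 1 ≤ N * η)
    (hchain : ∀ i < N + 2, chainTerm p η (i + 1) ∈ closedRightIdeal (chainTerm p η i)) (m : ℕ) :
    cutdown (p (m + 1).bodd) ((m + 4) * η) ≤ cutdown (p m.bodd) ((m + 1) * η) := by
  suffices ∀ j m : ℕ, N ≤ m + j →
      cutdown (p (m + 1).bodd) ((m + 4) * η) ≤ cutdown (p m.bodd) ((m + 1) * η) from
    this N m (by omega)
  intro j
  induction j with
  | zero =>
    intro m hm
    have : (N : ℝ) ≤ m := by exact_mod_cast hm
    rw [cutdown_eq_zero (hp _) (hp1 _) (by nlinarith)]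
    exact cutdown_nonneg _ _
  | succ j ih =>
    intro m hm
    rcases le_or_gt N m with h | h
    · have : (N : ℝ) ≤ m := by exact_mod_cast h
      rw [cutdown_eq_zero (hp _) (hp1 _) (by nlinarith)]
      exact cutdown_nonneg _ _
    refine cutdown_le_cutdown_of_mem (.of_nonneg (hp _)) (.of_nonneg (hp _)) (δ := 2 * η)
      (by positivity) ?_ ?_
    · have := hchain (m + 2) (by omega)
      simp only [chainTerm, Nat.bodd_succ, Bool.not_not] at this ⊢
      push_cast at this
      convert this using 3 <;> ring_nf
    · have := ih (m + 2) (by omega)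
      simp only [Nat.bodd_succ, Bool.not_not] at this ⊢
      push_cast at this
      convert this using 2 <;> ring

theorem norm_sub_le_of_cutdown_le {x y : A} (hx : 0 ≤ x) (hy : 0 ≤ y) {s t : ℝ} (ht : 0 ≤ t)
    (hxy : cutdown x t ≤ y) (hyx : cutdown y s ≤ x) : ‖x - y‖ ≤ max t s := by
  have key {x y : A} {t : ℝ} (hx : 0 ≤ x) (h : cutdown x t ≤ y) : x - y ≤ algebraMap ℝ A t := by
    have h1 : x ≤ cutdown x t + algebraMap ℝ A t := by
      rw [cutdown, ← cfc_const t x, ← cfc_add x _ _ (by fun_prop) (by fun_prop)]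
      nth_rw 1 [← cfc_id' ℝ x]
      exact cfc_mono fun q _ ↦ by linarith [le_max_left (q - t) 0]
    rw [sub_le_iff_le_add']
    exact h1.trans (by gcongr)
  have h1 := (key hx hxy).trans (algebraMap_mono A (le_max_left t s))
  have h2 := (key hy hyx).trans (algebraMap_mono A (le_max_right t s))
  have hsa : IsSelfAdjoint (x - y) := (IsSelfAdjoint.of_nonneg hx).sub (.of_nonneg hy)
  have h3 : algebraMap ℝ A (-max t s) ≤ x - y := by
    rw [map_neg, neg_le, neg_sub]
    exact h2
  have h4 := (le_algebraMap_iff_spectrum_le (ha := hsa)).1 h1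
  have h5 := (algebraMap_le_iff_le_spectrum (ha := hsa)).1 h3
  rw [← cfc_id' ℝ (x - y)]
  exact norm_cfc_le (le_max_of_le_left ht) fun q hq ↦ abs_le.2 ⟨h5 q hq, h4 q hq⟩

/-- The unital form of the main result. -/
theorem exists_unitary_norm_conj_sub_lt (hA : Dense {x : A | IsUnit x}) {a b : A} (ha : 0 ≤ a)
    (ha1 : ‖a‖ ≤ 1) (hb : 0 ≤ b) (hb1 : ‖b‖ ≤ 1)
    (h : ∀ t ∈ Set.Ioo (0 : ℝ) 1, CuntzEquivalent (cutdown a t) (cutdown b t)) {ε : ℝ}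
    (hε : 0 < ε) : ∃ u ∈ unitary A, ‖star u * a * u - b‖ < ε := by
  set α : Bool → A := fun β ↦ bif β then b else a with hα
  have hα0 (β) : 0 ≤ α β := by cases β <;> assumption
  have hα1 (β) : ‖α β‖ ≤ 1 := by cases β <;> assumption
  have hcut : ∀ β, ∀ t > 0, CuntzSubequivalent (cutdown (α β) t) (cutdown (α !β) t) := by
    intro β t ht
    rcases lt_or_ge t 1 with ht1 | ht1
    · cases β
      · exact (h t ⟨ht, ht1⟩).1
      · exact (h t ⟨ht, ht1⟩).2
    · rw [cutdown_eq_zero (hα0 _) (hα1 _) ht1, cutdown_eq_zero (hα0 _) (hα1 _) ht1]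
      exact ⟨0, by simp⟩
  set η : ℝ := ε / 6 with hη'
  have hη : 0 < η := by positivity
  obtain ⟨N, hN⟩ := exists_nat_ge (1 / η)
  rw [div_le_iff₀ hη] at hN
  obtain ⟨p, hp, hchain⟩ := exists_chain hA (fun β ↦ .of_nonneg (hα0 β)) hcut hη (N + 2)
  have hp0 (β) : 0 ≤ p β := by
    obtain ⟨u, -, hu⟩ := hp β
    exact hu ▸ star_right_conjugate_nonneg (hα0 β) u
  have hp1 (β) : ‖p β‖ ≤ 1 := by
    obtain ⟨u, hu, hpu⟩ := hp β
    rw [hpu, CStarRing.norm_mul_mem_unitary _ (Unitary.star_mem hu),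
      CStarRing.norm_mem_unitary_mul _ hu]
    exact hα1 β
  have hcle {x : A} (hx : 0 ≤ x) {t : ℝ} (ht : 0 ≤ t) : cutdown x t ≤ x := by
    have hxsa : IsSelfAdjoint x := .of_nonneg hx
    nth_rw 2 [← cfc_id' ℝ x]
    exact cfc_mono fun q hq ↦
      max_le (by linarith) (spectrum_nonneg_of_nonneg hx hq)
  have h0 := cutdown_le_of_chain hp0 hp1 hη hN hchain 0
  have h1 := cutdown_le_of_chain hp0 hp1 hη hN hchain 1
  simp only [Nat.bodd_succ, Nat.bodd_zero, Bool.not_false, Bool.not_true] at h0 h1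
  have hnorm := norm_sub_le_of_cutdown_le (hp0 false) (hp0 true) (s := (((0 : ℕ) : ℝ) + 4) * η)
    (t := (((1 : ℕ) : ℝ) + 4) * η) (by positivity)
    (h1.trans (hcle (hp0 _) (by positivity))) (h0.trans (hcle (hp0 _) (by positivity)))
  obtain ⟨u, hu, hpu⟩ := hp false
  obtain ⟨w, hw, hpw⟩ := hp true
  refine ⟨star u * w, mul_mem (Unitary.star_mem hu) hw, ?_⟩
  have e : star (star u * w) * a * (star u * w) - b = star w * (p false - p true) * w := by
    have hb' : star w * p true * w = b := by
      rw [hpw]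
      simp only [mul_assoc, Unitary.star_mul_self_of_mem hw, mul_one]
      simp only [← mul_assoc, Unitary.star_mul_self_of_mem hw, one_mul]
      rfl
    rw [mul_sub, sub_mul, hb', hpu, star_mul, star_star]
    simp only [hα, cond_false, mul_assoc]
  rw [e, CStarRing.norm_mul_mem_unitary _ hw,
    CStarRing.norm_mem_unitary_mul _ (Unitary.star_mem hw)]
  refine hnorm.trans_lt (max_lt ?_ ?_) <;> push_cast <;> linarith

end Estimate

theorem CuntzSubequivalent.inr {B : Type*} [NonUnitalCStarAlgebra B] {a b : B}
    (h : CuntzSubequivalent a b) :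
    CuntzSubequivalent (a : Unitization ℂ B) (b : Unitization ℂ B) := by
  obtain ⟨d, hd⟩ := h
  refine ⟨fun n ↦ (d n : Unitization ℂ B), ?_⟩
  simpa [Function.comp_def] using
    ((Unitization.isometry_inr (𝕜 := ℂ) (A := B)).continuous.tendsto a).comp hd

/-- Uniqueness half of the classification of homomorphisms from `C₀(0,1]` into a
stable rank one C*-algebra: if `a, b` are positive contractions such that
`(a − t)₊` and `(b − t)₊` are Cuntz equivalent for every `t ∈ (0,1)`, then `a` and `b`
are approximately unitarily equivalent via unitaries of the unitization `B~`. -/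
theorem approxUnitarilyEquivalent_of_cuntzEquivalent_cutdowns
    {B : Type*} [NonUnitalCStarAlgebra B] [PartialOrder B] [StarOrderedRing B]
    (hB : StableRankOne B)
    (a b : B) (ha : 0 ≤ a) (ha1 : ‖a‖ ≤ 1) (hb : 0 ≤ b) (hb1 : ‖b‖ ≤ 1)
    (h : ∀ t ∈ Set.Ioo (0 : ℝ) 1,
      CuntzEquivalent (cfcₙ (fun s : ℝ => max (s - t) 0) a)
        (cfcₙ (fun s : ℝ => max (s - t) 0) b)) :
    ∀ ε : ℝ, 0 < ε → ∃ u ∈ unitary (Unitization ℂ B),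
      ‖star u * (a : Unitization ℂ B) * u - (b : Unitization ℂ B)‖ < ε := by
  intro ε hε
  let : PartialOrder (Unitization ℂ B) := CStarAlgebra.spectralOrder _
  have : StarOrderedRing (Unitization ℂ B) := CStarAlgebra.spectralOrderedRing _
  refine exists_unitary_norm_conj_sub_lt hB (Unitization.inr_nonneg_iff.2 ha)
    (by rwa [Unitization.norm_inr]) (Unitization.inr_nonneg_iff.2 hb)
    (by rwa [Unitization.norm_inr]) (fun t ht ↦ ?_) hε
  have hcut (x : B) : cutdown (x : Unitization ℂ B) t =
      (cfcₙ (fun s : ℝ ↦ max (s - t) 0) x : B) :=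
    (Unitization.real_cfcₙ_eq_cfc_inr x _ (by simpa using ht.1.le)).symm
  rw [hcut, hcut]
  exact ⟨(h t ht).1.inr, (h t ht).2.inr⟩
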